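/- Under the stated hypotheses (in particular M ≤ √π/(2√r)), the function u satisfies u(p) ≤ M for every p ∈ (0, b). -/

import Mathlib

/-- The standard normal density `φ(z) = exp(-z²/2)/√(2π)`. -/
noncomputable def npdf (z : ℝ) : ℝ := (Real.sqrt (2 * Real.pi))⁻¹ * Real.exp (-z ^ 2 / 2)

/-- The standard normal distribution function `Φ(y) = ∫_{-∞}^y φ(z) dz`. -/
noncomputable def ncdf (y : ℝ) : ℝ := ∫ z in Set.Iic y, npdf z

/-- The standard normal tail function `Ψ(y) = 1 - Φ(y)`. -/
noncomputable def ntail (y : ℝ) : ℝ := 1 - ncdf y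

/-- The function `F(y) = φ(y) - y·Ψ(y)`. -/
noncomputable def Fstat (y : ℝ) : ℝ := npdf y - y * ntail y


lemma aux_npdf_eq : npdf = fun z => (Real.sqrt (2 * Real.pi))⁻¹ * Real.exp (-(1/2) * z ^ 2) := by
  funext z
  unfold npdf
  congr 2
  ring

lemma aux_npdf_cont : Continuous npdf := by
  rw [aux_npdf_eq]; fun_prop

lemma aux_npdf_int : MeasureTheory.Integrable npdf := by
  rw [aux_npdf_eq]
  exact (integrable_exp_neg_mul_sq (by norm_num : (0:ℝ) < 1/2)).const_mul _

lemma aux_npdf_pos (z : ℝ) : 0 < npdf z := by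
  unfold npdf; positivity

lemma aux_npdf_total : ∫ z, npdf z = 1 := by
  rw [aux_npdf_eq, MeasureTheory.integral_const_mul, integral_gaussian]
  have : Real.pi / (1/2) = 2 * Real.pi := by ring
  rw [this]
  exact inv_mul_cancel₀ (by positivity)

lemma aux_ntail_zero : ntail 0 = 1 / 2 := by
  unfold ntail ncdf
  have h1 : ∫ z in Set.Ioi (0:ℝ), npdf z = 1 / 2 := by
    rw [aux_npdf_eq, MeasureTheory.integral_const_mul, integral_gaussian_Ioi]
    have : Real.pi / (1/2) = 2 * Real.pi := by ring
    rw [this]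
    have h : Real.sqrt (2 * Real.pi) ≠ 0 := by positivity
    field_simp
  have h2 := MeasureTheory.integral_add_compl (measurableSet_Iic (a := (0:ℝ))) aux_npdf_int
  rw [Set.compl_Iic, h1, aux_npdf_total] at h2
  linarith

lemma aux_ntail_nonneg (y : ℝ) : 0 ≤ ntail y := by
  unfold ntail ncdf
  have h := MeasureTheory.setIntegral_le_integral (s := Set.Iic y) aux_npdf_int
    (Filter.Eventually.of_forall fun z => (aux_npdf_pos z).le)
  rw [aux_npdf_total] at h
  linarith

lemma aux_ntail_deriv (y : ℝ) : HasDerivAt ntail (-npdf y) y := by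
  have h : ntail = fun y => ntail 0 - ∫ z in (0:ℝ)..y, npdf z := by
    funext x
    have := intervalIntegral.integral_Iic_sub_Iic (a := (0:ℝ)) (b := x)
      aux_npdf_int.integrableOn aux_npdf_int.integrableOn
    unfold ntail ncdf
    rw [← this]; ring
  rw [h]
  exact (intervalIntegral.integral_hasDerivAt_right (aux_npdf_cont.intervalIntegrable _ _)
    (aux_npdf_cont.stronglyMeasurableAtFilter _ _) aux_npdf_cont.continuousAt).const_sub _

lemma aux_npdf_deriv (y : ℝ) : HasDerivAt npdf (-y * npdf y) y := by
  have h : HasDerivAt (fun z : ℝ => -z ^ 2 / 2) (-y) y := by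
    have := ((hasDerivAt_pow 2 y).neg).div_const 2
    refine this.congr_deriv ?_
    norm_num; ring
  have h2 := (h.exp).const_mul (Real.sqrt (2 * Real.pi))⁻¹
  refine h2.congr_deriv ?_
  unfold npdf; ring

lemma aux_D (k : ℝ) (hk : 0 < k) (h0 : 2 * k * npdf 0 = 1) (y : ℝ) (hy : 0 ≤ y) :
    0 ≤ ntail y + (y - k) * npdf y := by
  rcases le_total k y with h | h
  · have := mul_nonneg (sub_nonneg.2 h) (aux_npdf_pos y).le
    linarith [aux_ntail_nonneg y]
  · have hd : ∀ x : ℝ, HasDerivAt (fun x => ntail x + (x - k) * npdf x)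
        (x * (k - x) * npdf x) x := by
      intro x
      have := (aux_ntail_deriv x).add (((hasDerivAt_id x).sub_const k).mul (aux_npdf_deriv x))
      refine this.congr_deriv ?_
      simp only [id]; ring
    have hm : MonotoneOn (fun x => ntail x + (x - k) * npdf x) (Set.Icc 0 k) := by
      apply monotoneOn_of_deriv_nonneg (convex_Icc 0 k)
      · exact fun x _ => (hd x).continuousAt.continuousWithinAt
      · exact fun x _ => (hd x).differentiableAt.differentiableWithinAt
      · intro x hx
        rw [interior_Icc] at hx
        rw [(hd x).deriv]
        exact mul_nonneg (mul_nonneg hx.1.le (by linarith [hx.2])) (aux_npdf_pos x).le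
    have := hm (Set.left_mem_Icc.2 hk.le) ⟨hy, h⟩ hy
    simp only [aux_ntail_zero] at this
    linarith

lemma aux_G (k : ℝ) (hk : 0 < k) (h0 : 2 * k * npdf 0 = 1) (y : ℝ) (hy : 0 ≤ y) :
    0 ≤ 1 - k ^ 2 / 2 + ntail y * (k ^ 2 + k * y) - 2 * k * npdf y := by
  have hd : ∀ x : ℝ, HasDerivAt
      (fun y => 1 - k ^ 2 / 2 + ntail y * (k ^ 2 + k * y) - 2 * k * npdf y)
      (k * (ntail x + (x - k) * npdf x)) x := by
    intro x
    have := (((aux_ntail_deriv x).mul (((hasDerivAt_id x).const_mul k).const_add (k^2))).const_add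
      (1 - k ^ 2 / 2)).sub ((aux_npdf_deriv x).const_mul (2 * k))
    refine this.congr_deriv ?_
    simp only [id]; ring
  have hm : MonotoneOn (fun y => 1 - k ^ 2 / 2 + ntail y * (k ^ 2 + k * y) - 2 * k * npdf y)
      (Set.Ici 0) := by
    apply monotoneOn_of_deriv_nonneg (convex_Ici 0)
    · exact fun x _ => (hd x).continuousAt.continuousWithinAt
    · exact fun x _ => (hd x).differentiableAt.differentiableWithinAt
    · intro x hx
      rw [interior_Ici] at hx
      rw [(hd x).deriv]
      exact mul_nonneg hk.le (aux_D k hk h0 x (le_of_lt hx))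
  have := hm (Set.self_mem_Ici) hy hy
  simp only [aux_ntail_zero] at this
  linarith

/-- with M ≤ √π/(2√r), b = Mπ√r/(√π + 2M√r), v the solution of
Ψ(√(2r)·v(p)) = (1−b)p/(2b(1−p)) and
u(p) = p·v(p) + M√(2π)·((1−p)/(1−b))·F(√(2r)·v(p)), one has u(p) ≤ M on (0,b). -/
theorem u_le_M (r M b : ℝ) (v u : ℝ → ℝ) (hr : 0 < r) (hM : 0 < M)
    (hMle : M ≤ Real.sqrt Real.pi / (2 * Real.sqrt r))
    (hb : b = M * Real.pi * Real.sqrt r / (Real.sqrt Real.pi + 2 * M * Real.sqrt r))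
    (hv : ∀ p ∈ Set.Ioo (0:ℝ) b, 0 < v p ∧
      ntail (Real.sqrt (2*r) * v p) = (1 - b) * p / (2 * b * (1 - p)))
    (hu : ∀ p ∈ Set.Ioo (0:ℝ) b, u p =
      p * v p + M * Real.sqrt (2 * Real.pi) * ((1 - p) / (1 - b))
        * Fstat (Real.sqrt (2*r) * v p)) :
    ∀ p ∈ Set.Ioo (0:ℝ) b, u p ≤ M := by
  intro p hp
  obtain ⟨hvp, hq⟩ := hv p hp
  rw [hu p hp]
  obtain ⟨hp0, hpb⟩ := hp
  obtain ⟨k, hk, hk2⟩ : ∃ k : ℝ, 0 < k ∧ Real.pi = 2 * k ^ 2 :=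
    ⟨Real.sqrt (Real.pi / 2), by positivity, by rw [Real.sq_sqrt (by positivity)]; ring⟩
  obtain ⟨t, ht, ht2, hte⟩ : ∃ t : ℝ, 0 < t ∧ t ^ 2 = 2 ∧ t = Real.sqrt 2 :=
    ⟨Real.sqrt 2, by positivity, by norm_num, rfl⟩
  obtain ⟨w, hw, hwe⟩ : ∃ w : ℝ, 0 < w ∧ w = Real.sqrt r := ⟨_, Real.sqrt_pos.2 hr, rfl⟩
  have e1 : Real.sqrt (2 * Real.pi) = 2 * k := by
    rw [hk2, show 2 * (2 * k ^ 2) = (2 * k) ^ 2 by ring]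
    exact Real.sqrt_sq (by positivity)
  have e2 : Real.sqrt Real.pi = t * k := by
    rw [hk2, ← ht2, ← mul_pow]; exact Real.sqrt_sq (by positivity)
  have e3 : Real.sqrt (2 * r) = t * w := by
    rw [Real.sqrt_mul (by norm_num), hte, hwe]
  have hpi : k ^ 2 < 2 := by linarith [Real.pi_lt_four]
  rw [e2, ← hwe] at hMle hb
  rw [hk2] at hb
  rw [e3] at hq ⊢
  rw [e1]
  have h0 : 2 * k * npdf 0 = 1 := by
    unfold npdf; rw [e1]; simp; field_simp
  rw [le_div_iff₀ (by positivity)] at hMle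
  have hden : 0 < t * k + 2 * M * w := by positivity
  have hbpos : 0 < b := by rw [hb]; positivity
  have hble : b ≤ k ^ 2 / 2 := by
    rw [hb, div_le_iff₀ hden]
    nlinarith [sq_nonneg k, mul_nonneg (sq_nonneg k) (sub_nonneg.2 hMle)]
  have hb1 : 0 < 1 - b := by linarith
  have hp1 : 0 < 1 - p := by linarith
  obtain ⟨y, hy⟩ : ∃ y, y = t * w * v p := ⟨_, rfl⟩
  have hy0 : 0 < y := by rw [hy]; positivity
  rw [← hy] at hq ⊢
  have hG := aux_G k hk h0 y hy0.le
  have hphi : 2 * k * npdf y ≤ 1 := by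
    unfold npdf
    rw [e1, ← mul_assoc, mul_inv_cancel₀ (by positivity), one_mul]
    exact Real.exp_le_one_iff.2 (by nlinarith [sq_nonneg y])
  unfold Fstat
  generalize npdf y = f at *
  generalize ntail y = q at *
  have hb' : b * (t * k + 2 * M * w) = M * (2 * k ^ 2) * w := by
    rw [hb]; field_simp
  have hq' : (1 - p) / (1 - b) * q = p / (2 * b) := by
    rw [hq]; field_simp
  -- interpolation in b
  have hI : 0 ≤ 1 - b + 2 * b * q * (1 + y / k) - 2 * k * f := by
    have hl : 0 ≤ 1 - 2 * b / k ^ 2 := by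
      rw [sub_nonneg, div_le_one (by positivity)]; linarith
    have h1 := mul_nonneg hl (sub_nonneg.2 hphi)
    have h2 := mul_nonneg (show 0 ≤ 2 * b / k ^ 2 by positivity) hG
    have h3 := add_nonneg h1 h2
    have h4 : 1 - b + 2 * b * q * (1 + y / k) - 2 * k * f = (1 - 2 * b / k ^ 2) * (1 - 2 * k * f)
        + 2 * b / k ^ 2 * (1 - k ^ 2 / 2 + q * (k ^ 2 + k * y) - 2 * k * f) := by
      field_simp
      ring
    rw [h4]; exact h3
  have hJ := mul_nonneg (show 0 ≤ M * ((1 - p) / (1 - b)) by positivity) hI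
  have hvv : p * v p = M * k * y * p / b - M * p * y / k := by
    have : v p = y * t / (2 * w) := by
      rw [hy]; field_simp; rw [ht2]
    rw [this]
    field_simp
    linear_combination hb'
  have hc : (1 - p) / (1 - b) * (1 - b) = 1 - p := by field_simp
  have hK : M * ((1 - p) / (1 - b)) * (1 - b + 2 * b * q * (1 + y / k) - 2 * k * f)
      = M * (1 - p) + M * p * (1 + y / k) - M * (2 * k) * ((1 - p) / (1 - b)) * f := by
    have h2 : 2 * b * (p / (2 * b)) = p := by field_simp
    linear_combination M * hc + M * 2 * b * (1 + y / k) * hq' + M * (1 + y / k) * h2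
  have hL : M * (2 * k) * ((1 - p) / (1 - b)) * (f - y * q)
      = M * (2 * k) * ((1 - p) / (1 - b)) * f - M * k * y * p / b := by
    have h2 : 2 * (p / (2 * b)) = p / b := by field_simp
    linear_combination (-(M * 2 * k * y)) * hq' - M * k * y * h2
  rw [hK] at hJ
  rw [hL, hvv]
  have : M * p * (1 + y / k) = M * p + M * p * y / k := by ring
  linarith
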